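/- For n ≥ 0 define the bivariate polynomial T_n(x,y) = Σ_{π ∈ S_n(1-3-2)} x^{f_2(π)} y^{f_3(π)} (with T_0 = 1). Then for all n ≥ 0, T_{n+1}(x,y) = T_n(xy, y) + x · Σ_{a+b=n, b≥1} T_a(xy, y)·T_b(x,y), where T_a(xy,y) denotes the polynomial T_a with x replaced by the product xy. -/

import Mathlib

/-- An occurrence of the classical pattern 1-3-2 in a sequence `w` of distinct
integers is a triple of indices `i < j < k` with `w i < w k < w j`;
`w` avoids 1-3-2 if it has no such occurrence. -/
def Avoids132 {m : ℕ} (w : Fin m → ℤ) : Prop :=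
  ∀ i j k : Fin m, i < j → j < k → ¬(w i < w k ∧ w k < w j)

/-- `π : Fin n → ℤ` is a permutation of length `n`, i.e. a sequence containing
each of the integers `1,…,n` exactly once. -/
def IsPermSeq (n : ℕ) (π : Fin n → ℤ) : Prop :=
  Function.Injective π ∧ ∀ i, 1 ≤ π i ∧ π i ≤ (n : ℤ)

/-- The prefix `π' = (π_1, …, π_{j-1})` of `π` strictly before position `j`. -/
def leftPart {n : ℕ} (π : Fin n → ℤ) (j : Fin n) : Fin (j : ℕ) → ℤ :=
  fun a => π ⟨(a : ℕ), lt_trans a.isLt j.isLt⟩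

/-- The suffix `π'' = (π_{j+1}, …, π_n)` of `π` strictly after position `j`. -/
def rightPart {n : ℕ} (π : Fin n → ℤ) (j : Fin n) : Fin (n - (j : ℕ) - 1) → ℤ :=
  fun a => π ⟨(j : ℕ) + 1 + (a : ℕ), by have h1 := a.isLt; have h2 := j.isLt; omega⟩

/-- An occurrence of the generalized pattern `12-3-…-k` in `w`:
indices `i 0 < i 1 < ⋯ < i (k-1)` with `i 1 = i 0 + 1` and
`w (i 0) < w (i 1) < ⋯ < w (i (k-1))`. -/
def Occ12 {m : ℕ} (k : ℕ) (w : Fin m → ℤ) (i : Fin k → Fin m) : Prop :=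
  StrictMono i ∧ StrictMono (w ∘ i) ∧
    ∀ a b : Fin k, (a : ℕ) = 0 → (b : ℕ) = 1 → (i b : ℕ) = (i a : ℕ) + 1

/-- The relative order of the letters of the pattern `21-3-…-k`. -/
def fPat (j : ℕ) : ℕ := if j = 0 then 1 else if j = 1 then 0 else j

/-- An occurrence of the generalized pattern `21-3-…-k` in `w`:
indices `i 0 < i 1 < ⋯ < i (k-1)` with `i 1 = i 0 + 1` and
`w (i 1) < w (i 0) < w (i 2) < ⋯ < w (i (k-1))`. -/
def Occ21 {m : ℕ} (k : ℕ) (w : Fin m → ℤ) (i : Fin k → Fin m) : Prop :=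
  StrictMono i ∧ (∀ a b : Fin k, fPat (a : ℕ) < fPat (b : ℕ) ↔ w (i a) < w (i b)) ∧
    ∀ a b : Fin k, (a : ℕ) = 0 → (b : ℕ) = 1 → (i b : ℕ) = (i a : ℕ) + 1

/-- `eStat k w` is the number of occurrences of the generalized pattern
`12-3-…-k` in `w` (for `k = 2` this is the number of ascents). -/
noncomputable def eStat (k : ℕ) {m : ℕ} (w : Fin m → ℤ) : ℕ :=
  Nat.card {i : Fin k → Fin m // Occ12 k w i}

/-- `fStat k w` is the number of occurrences of the generalized pattern
`21-3-…-k` in `w` (for `k = 2` this is the number of descents). -/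
noncomputable def fStat (k : ℕ) {m : ℕ} (w : Fin m → ℤ) : ℕ :=
  Nat.card {i : Fin k → Fin m // Occ21 k w i}

/-- The number of ascents of `w`: indices `i` with `w i < w (i+1)`. -/
noncomputable def asc {m : ℕ} (w : Fin m → ℤ) : ℕ :=
  Nat.card {p : Fin m × Fin m // (p.2 : ℕ) = (p.1 : ℕ) + 1 ∧ w p.1 < w p.2}

/-- The number of descents of `w`: indices `i` with `w i > w (i+1)`. -/
noncomputable def des {m : ℕ} (w : Fin m → ℤ) : ℕ :=
  Nat.card {p : Fin m × Fin m // (p.2 : ℕ) = (p.1 : ℕ) + 1 ∧ w p.2 < w p.1}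

/-- `totE w = Σ_{k ≥ 2} e_k(w)`: the total number of 2-increasing
subsequences of `w`. -/
noncomputable def totE {m : ℕ} (w : Fin m → ℤ) : ℕ :=
  Nat.card ((k : ℕ) × {i : Fin k → Fin m // 2 ≤ k ∧ Occ12 k w i})

/-- `totF w = Σ_{k ≥ 2} f_k(w)`: the total number of almost 2-increasing
subsequences of `w`. -/
noncomputable def totF {m : ℕ} (w : Fin m → ℤ) : ℕ :=
  Nat.card ((k : ℕ) × {i : Fin k → Fin m // 2 ≤ k ∧ Occ21 k w i})

open Finset

lemma fStat_two_eq_sum {m : ℕ} (w : Fin m → ℤ) :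
    fStat 2 w = ∑ i : Fin m, ∑ j : Fin m, if (j : ℕ) = i + 1 ∧ w j < w i then 1 else 0 := by
  have e : {i : Fin 2 → Fin m // Occ21 2 w i} ≃
      {p : Fin m × Fin m // (p.2 : ℕ) = p.1 + 1 ∧ w p.2 < w p.1} :=
    { toFun := fun i => ⟨(i.1 0, i.1 1), i.2.2.2 0 1 rfl rfl, (i.2.2.1 1 0).1 (by decide)⟩
      invFun := fun p => ⟨![p.1.1, p.1.2], by
        obtain ⟨⟨p, q⟩, h₁, h₂⟩ := p
        dsimp only at h₁ h₂
        refine ⟨?_, ?_, ?_⟩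
        · rw [Fin.strictMono_iff_lt_succ]
          intro i
          fin_cases i
          simp [Fin.lt_def, h₁]
        · intro a b
          fin_cases a <;> fin_cases b <;> simp [fPat, h₂, h₂.le]
        · intro a b ha hb
          fin_cases a <;> fin_cases b <;> simp_all⟩
      left_inv := fun i => by
        ext k
        fin_cases k <;> rfl
      right_inv := fun p => rfl }
  rw [fStat, Nat.card_congr e, Nat.card_eq_fintype_card, Fintype.card_subtype, card_filter,
    Fintype.sum_prod_type]

lemma fStat_three_eq_sum {m : ℕ} (w : Fin m → ℤ) :
    fStat 3 w = ∑ i : Fin m, ∑ j : Fin m, ∑ k : Fin m,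
      if ((j : ℕ) = i + 1 ∧ w j < w i) ∧ j < k ∧ w i < w k then 1 else 0 := by
  have e : {i : Fin 3 → Fin m // Occ21 3 w i} ≃
      {p : Fin m × Fin m × Fin m //
        ((p.2.1 : ℕ) = p.1 + 1 ∧ w p.2.1 < w p.1) ∧ p.2.1 < p.2.2 ∧ w p.1 < w p.2.2} :=
    { toFun := fun i => ⟨(i.1 0, i.1 1, i.1 2),
        ⟨i.2.2.2 0 1 rfl rfl, (i.2.2.1 1 0).1 (by decide)⟩,
        i.2.1 (by decide), (i.2.2.1 0 2).1 (by decide)⟩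
      invFun := fun p => ⟨![p.1.1, p.1.2.1, p.1.2.2], by
        obtain ⟨⟨p, q, r⟩, ⟨h₁, h₂⟩, h₃, h₄⟩ := p
        dsimp only at h₁ h₂ h₃ h₄
        refine ⟨?_, ?_, ?_⟩
        · rw [Fin.strictMono_iff_lt_succ]
          intro i
          fin_cases i
          · simp [Fin.lt_def, h₁]
          · simpa using h₃
        · intro a b
          fin_cases a <;> fin_cases b <;>
            simp [fPat, h₂, h₂.le, h₄, h₄.le, h₂.trans h₄, (h₂.trans h₄).le]
        · intro a b ha hb
          fin_cases a <;> fin_cases b <;> simp_all⟩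
      left_inv := fun i => by
        ext k
        fin_cases k <;> rfl
      right_inv := fun p => rfl }
  rw [fStat, Nat.card_congr e, Nat.card_eq_fintype_card, Fintype.card_subtype, card_filter,
    Fintype.sum_prod_type]
  simp only [Fintype.sum_prod_type]

section Append

variable {a b : ℕ} {L : Fin a → ℤ} {R : Fin b → ℤ} {M : ℤ}

lemma fStat_two_append_cons (hL : ∀ i, L i < M) (hR : ∀ i, R i < M) :
    fStat 2 (Fin.append L (Fin.cons M R : Fin (b + 1) → ℤ)) =
      fStat 2 L + fStat 2 R + if b = 0 then 0 else 1 := by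
  have h₁ (i : Fin a) (j : Fin b) : ¬ a + (j + 1 : ℕ) = i + 1 := by omega
  have h₂ (i : Fin a) (j : Fin b) : ¬ (i : ℕ) = a + (j + 1 : ℕ) + 1 := by omega
  have h₃ (i : Fin a) : ¬ (i : ℕ) = a + 1 := by omega
  have h₄ (i j : Fin b) : a + (j + 1 : ℕ) = a + (i + 1 : ℕ) + 1 ↔ (j : ℕ) = i + 1 := by omega
  have h₅ : (∑ j : Fin b, if (j : ℕ) = 0 then 1 else 0) = if b = 0 then 0 else 1 := by
    cases b <;> simp
  simp [-sum_boole, fStat_two_eq_sum, Fin.sum_univ_add, Fin.sum_univ_succ, (hL _).not_gt, hR,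
    h₁, h₂, h₃, h₄, h₅, (hR _).not_gt]
  omega

lemma fStat_three_append_cons (hL : ∀ i, L i < M) (hR : ∀ i, R i < M)
    (hLR : ∀ i j, R j < L i) :
    fStat 3 (Fin.append L (Fin.cons M R : Fin (b + 1) → ℤ)) =
      fStat 3 L + fStat 2 L + fStat 3 R := by
  have h₁ (i : Fin a) (j : Fin b) : ¬ a + (j + 1 : ℕ) = i + 1 := by omega
  have h₂ (i : Fin a) : ¬ (i : ℕ) = a + 1 := by omega
  have h₃ (i : Fin a) (j : Fin b) : ¬ a + (j + 1 : ℕ) < i := by omega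
  simp [-sum_boole, -Fin.val_fin_lt, fStat_two_eq_sum, fStat_three_eq_sum, Fin.sum_univ_add,
    Fin.sum_univ_succ, (hL _).not_gt, hR, hL, h₁, h₂, (hR _).not_gt, (hLR _ _).not_gt, Fin.lt_def, h₃,
    sum_add_distrib, add_assoc]

end Append

lemma fStat_add_const (k : ℕ) {m : ℕ} (w : Fin m → ℤ) (c : ℤ) :
    fStat k (fun i => w i + c) = fStat k w := by
  simp [fStat, Occ21]

open Classical in
/-- The permutations of length `n` avoiding 1-3-2. -/
noncomputable def perms132 (n : ℕ) : Finset (Fin n → ℤ) :=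
  {π ∈ Fintype.piFinset fun _ => Icc (1 : ℤ) n | IsPermSeq n π ∧ Avoids132 π}

lemma mem_perms132 {n : ℕ} {π : Fin n → ℤ} :
    π ∈ perms132 n ↔ IsPermSeq n π ∧ Avoids132 π := by
  simp only [perms132, mem_filter, Fintype.mem_piFinset, mem_Icc, and_iff_right_iff_imp]
  exact fun h => h.1.2

lemma IsPermSeq.exists_eq {n : ℕ} {π : Fin n → ℤ} (h : IsPermSeq n π) {v : ℤ}
    (h₁ : 1 ≤ v) (h₂ : v ≤ n) : ∃ i, π i = v := by
  have key : univ.image π = Icc (1 : ℤ) n := by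
    refine eq_of_subset_of_card_le ?_ ?_
    · intro x hx
      obtain ⟨i, -, rfl⟩ := mem_image.1 hx
      exact mem_Icc.2 (h.2 i)
    · simp [card_image_of_injective _ h.1]
  have : v ∈ univ.image π := key ▸ mem_Icc.2 ⟨h₁, h₂⟩
  simpa using this

lemma le_sub_of_injective {m : ℕ} {f : Fin m → ℤ} (hf : Function.Injective f) {u v : ℤ}
    (huv : u ≤ v) (h : ∀ i, u < f i ∧ f i ≤ v) : (m : ℤ) ≤ v - u := by
  have := card_le_card (s := univ.image f) (t := Ioc u v) fun x hx => by
    obtain ⟨i, -, rfl⟩ := mem_image.1 hx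
    exact mem_Ioc.2 (h i)
  rw [card_image_of_injective _ hf, card_univ, Fintype.card_fin, Int.card_Ioc] at this
  omega

/-- The sequence `L + b, a + b + 1, R`. -/
def glue132 {a b : ℕ} (L : Fin a → ℤ) (R : Fin b → ℤ) : Fin (a + b + 1) → ℤ :=
  (Fin.append (fun i => L i + b) (Fin.cons ((a + b + 1 : ℕ) : ℤ) R : Fin (b + 1) → ℤ) :
    Fin (a + (b + 1)) → ℤ)

lemma forall_fin_add_succ {a b : ℕ} {P : Fin (a + b + 1) → Prop} :
    (∀ i, P i) ↔ (∀ i : Fin a, P (Fin.castAdd (b + 1) i)) ∧ P (Fin.natAdd a (0 : Fin (b + 1))) ∧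
      ∀ i : Fin b, P (Fin.natAdd a i.succ) := by
  refine ⟨fun h => ⟨fun _ => h _, h _, fun _ => h _⟩, fun ⟨h₁, h₂, h₃⟩ i => ?_⟩
  induction i using Fin.addCases (m := a) (n := b + 1) with
  | left i => exact h₁ i
  | right i => exact Fin.cases h₂ h₃ i

section Glue

variable {a b : ℕ} (L : Fin a → ℤ) (R : Fin b → ℤ)

@[simp] lemma glue132_left (i : Fin a) : glue132 L R (Fin.castAdd (b + 1) i) = L i + b := by
  simp [glue132]

@[simp] lemma glue132_mid :
    glue132 L R (Fin.natAdd a (0 : Fin (b + 1))) = ((a + b + 1 : ℕ) : ℤ) := by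
  rw [glue132, Fin.append_right, Fin.cons_zero]

@[simp] lemma glue132_right (i : Fin b) : glue132 L R (Fin.natAdd a i.succ) = R i := by
  rw [glue132, Fin.append_right, Fin.cons_succ]

variable {L R}

lemma glue132_mem (hL : L ∈ perms132 a) (hR : R ∈ perms132 b) :
    glue132 L R ∈ perms132 (a + b + 1) := by
  rw [mem_perms132] at *
  obtain ⟨⟨hLi, hLb⟩, hLa⟩ := hL
  obtain ⟨⟨hRi, hRb⟩, hRa⟩ := hR
  refine ⟨⟨?_, ?_⟩, ?_⟩
  · simp only [Function.Injective, forall_fin_add_succ, glue132_left, glue132_mid, glue132_right]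
    refine ⟨fun i => ⟨fun j h => ?_, fun h => ?_, fun j h => ?_⟩,
      ⟨fun j h => ?_, fun _ => trivial, fun j h => ?_⟩,
      fun i => ⟨fun j h => ?_, fun h => ?_, fun j h => ?_⟩⟩
    · rw [hLi (add_right_cancel h)]
    · have := hLb i; omega
    · have := hLb i; have := hRb j; omega
    · have := hLb j; omega
    · have := hRb j; omega
    · have := hLb j; have := hRb i; omega
    · have := hRb i; omega
    · rw [hRi h]
  · simp only [forall_fin_add_succ, glue132_left, glue132_mid, glue132_right]
    refine ⟨fun i => ?_, ?_, fun i => ?_⟩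
    · have := hLb i; omega
    · omega
    · have := hRb i; omega
  · simp only [Avoids132, forall_fin_add_succ, glue132_left, glue132_mid, glue132_right]
    simp only [Fin.lt_def, Fin.val_castAdd, Fin.val_natAdd, Fin.val_succ, Fin.val_zero]
    refine ⟨fun i => ⟨fun j => ⟨fun k h₁ h₂ => ?_, fun _ _ => ?_, fun k _ _ => ?_⟩,
      ⟨fun k _ _ => ?_, fun _ _ => ?_, fun k _ _ => ?_⟩,
      fun j => ⟨fun k _ _ => ?_, fun _ _ => ?_, fun k _ _ => ?_⟩⟩,
      ⟨fun j => ⟨fun k _ _ => ?_, fun _ _ => ?_, fun k _ _ => ?_⟩,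
      ⟨fun k _ _ => ?_, fun _ _ => ?_, fun k _ _ => ?_⟩,
      fun j => ⟨fun k _ _ => ?_, fun _ _ => ?_, fun k _ _ => ?_⟩⟩,
      fun i => ⟨fun j => ⟨fun k _ _ => ?_, fun _ _ => ?_, fun k _ _ => ?_⟩,
      ⟨fun k _ _ => ?_, fun _ _ => ?_, fun k _ _ => ?_⟩,
      fun j => ⟨fun k _ _ => ?_, fun _ _ => ?_, fun k h₁ h₂ => hRa i j k ?_ ?_⟩⟩⟩
    · have := hLa i j k h₁ h₂; omega
    all_goals
      try have := hLb i
      try have := hLb j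
      try have := hLb k
      try have := hRb i
      try have := hRb j
      try have := hRb k
      omega

lemma fStat_two_glue132 (hL : L ∈ perms132 a) (hR : R ∈ perms132 b) :
    fStat 2 (glue132 L R) = fStat 2 L + fStat 2 R + if b = 0 then 0 else 1 := by
  have hLb := (mem_perms132.1 hL).1.2
  have hRb := (mem_perms132.1 hR).1.2
  rw [← fStat_add_const 2 L b]
  refine fStat_two_append_cons (fun i => ?_) fun i => ?_
  · have := hLb i; omega
  · have := hRb i; omega

lemma fStat_three_glue132 (hL : L ∈ perms132 a) (hR : R ∈ perms132 b) :
    fStat 3 (glue132 L R) = fStat 3 L + fStat 2 L + fStat 3 R := by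
  have hLb := (mem_perms132.1 hL).1.2
  have hRb := (mem_perms132.1 hR).1.2
  rw [← fStat_add_const 2 L b, ← fStat_add_const 3 L b]
  refine fStat_three_append_cons (fun i => ?_) (fun i => ?_) fun i j => ?_
  · have := hLb i; omega
  · have := hRb i; omega
  · have := hLb i; have := hRb j; omega

lemma parts_mem_perms132 {π : Fin (a + b + 1) → ℤ} (hπ : π ∈ perms132 (a + b + 1))
    (hmax : π (Fin.natAdd a (0 : Fin (b + 1))) = ((a + b + 1 : ℕ) : ℤ)) :
    (fun i : Fin a => π (Fin.castAdd (b + 1) i) - b) ∈ perms132 a ∧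
      (fun i : Fin b => π (Fin.natAdd a i.succ)) ∈ perms132 b := by
  rw [mem_perms132] at hπ
  simp only [mem_perms132]
  obtain ⟨⟨hi, hb⟩, ha⟩ := hπ
  have hLi : Function.Injective fun i : Fin a => π (Fin.castAdd (b + 1) i) :=
    hi.comp (Fin.castAdd_injective _ _)
  have hRi : Function.Injective fun i : Fin b => π (Fin.natAdd a i.succ) :=
    hi.comp ((Fin.natAdd_injective _ _).comp (Fin.succ_injective _))
  have hL (i : Fin a) : π (Fin.castAdd (b + 1) i) < (a + b + 1 : ℕ) := by
    refine lt_of_le_of_ne (hb _).2 fun h => ?_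
    have := congrArg Fin.val (hi (h.trans hmax.symm))
    simp at this
    omega
  have hR (i : Fin b) : π (Fin.natAdd a i.succ) < (a + b + 1 : ℕ) := by
    refine lt_of_le_of_ne (hb _).2 fun h => ?_
    have := congrArg Fin.val (hi (h.trans hmax.symm))
    simp at this
  have hLR (i : Fin a) (j : Fin b) : π (Fin.natAdd a j.succ) < π (Fin.castAdd (b + 1) i) := by
    by_contra! h
    have hne : π (Fin.castAdd (b + 1) i) ≠ π (Fin.natAdd a j.succ) := fun h => by
      have := congrArg Fin.val (hi h)
      simp at this
      omega
    refine ha (Fin.castAdd (b + 1) i) (Fin.natAdd a (0 : Fin (b + 1))) (Fin.natAdd a j.succ)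
      ?_ ?_ ⟨lt_of_le_of_ne h hne, hmax ▸ hR j⟩ <;> simp [Fin.lt_def, -Fin.val_fin_lt]
  refine ⟨⟨⟨fun i j h => hLi (sub_left_injective h), fun i => ?_⟩, fun i j k h₁ h₂ h => ?_⟩,
    ⟨hRi, fun j => ?_⟩, fun i j k h₁ h₂ h => ?_⟩
  · have h₁ := le_sub_of_injective hRi (u := 0) (v := π (Fin.castAdd (b + 1) i) - 1)
      (by have := hb (Fin.castAdd (b + 1) i); omega)
      fun j => by have := hb (Fin.natAdd a j.succ); have := hLR i j; omega
    have := hL i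
    dsimp only
    omega
  · refine ha (Fin.castAdd (b + 1) i) (Fin.castAdd (b + 1) j) (Fin.castAdd (b + 1) k) h₁ h₂ ?_
    dsimp only at h
    omega
  · have h₁ := le_sub_of_injective hLi (u := π (Fin.natAdd a j.succ)) (v := a + b)
      (by have := hR j; omega)
      fun i => by have := hL i; have := hLR i j; omega
    have := hb (Fin.natAdd a j.succ)
    dsimp only
    omega
  · exact ha (Fin.natAdd a i.succ) (Fin.natAdd a j.succ) (Fin.natAdd a k.succ)
      (by simpa [Fin.lt_def, -Fin.val_fin_lt] using h₁) (by simpa [Fin.lt_def, -Fin.val_fin_lt] using h₂) h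

end Glue

lemma sum_perms132_max_eq {β : Type*} [AddCommMonoid β] {a b : ℕ}
    (f : (Fin (a + b + 1) → ℤ) → β) :
    ∑ π ∈ perms132 (a + b + 1) with
        π (Fin.natAdd a (0 : Fin (b + 1))) = ((a + b + 1 : ℕ) : ℤ), f π =
      ∑ L ∈ perms132 a, ∑ R ∈ perms132 b, f (glue132 L R) := by
  rw [← sum_product']
  symm
  refine sum_nbij' (fun p => glue132 p.1 p.2)
    (fun π => (fun i => π (Fin.castAdd (b + 1) i) - b, fun i => π (Fin.natAdd a i.succ)))
    ?_ ?_ ?_ ?_ ?_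
  · rintro ⟨L, R⟩ h
    rw [mem_product] at h
    exact mem_filter.2 ⟨glue132_mem h.1 h.2, glue132_mid L R⟩
  · intro π h
    rw [mem_filter] at h
    exact mem_product.2 (parts_mem_perms132 h.1 h.2)
  · rintro ⟨L, R⟩ -
    simp
  · intro π h
    rw [mem_filter] at h
    rw [funext_iff, forall_fin_add_succ]
    simp [h.2]
  · intro _ _
    rfl

lemma sum_perms132_succ {β : Type*} [AddCommMonoid β] (n : ℕ) (f : (Fin (n + 1) → ℤ) → β) :
    ∑ π ∈ perms132 (n + 1), f π =
      ∑ j : Fin (n + 1), ∑ π ∈ perms132 (n + 1) with π j = ((n + 1 : ℕ) : ℤ), f π := by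
  simp only [sum_filter]
  rw [sum_comm]
  refine sum_congr rfl fun π hπ => ?_
  have h := (mem_perms132.1 hπ).1
  obtain ⟨j, hj⟩ := h.exists_eq (v := ((n + 1 : ℕ) : ℤ)) (by omega) le_rfl
  rw [sum_eq_single j (fun i _ hi => if_neg fun h' => hi (h.1 (h'.trans hj.symm))) (by simp),
    if_pos hj]

section Weight

open MvPolynomial

/-- The monomial `x ^ f₂(w) * y ^ f₃(w)`. -/
noncomputable def weight132 {m : ℕ} (w : Fin m → ℤ) : MvPolynomial (Fin 2) ℤ :=
  X 0 ^ fStat 2 w * X 1 ^ fStat 3 w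

lemma eq_sum_weight132 {n : ℕ} {p : MvPolynomial (Fin 2) ℤ}
    (hp : ∀ s : Fin 2 →₀ ℕ, coeff s p =
      (Nat.card {π : Fin n → ℤ // IsPermSeq n π ∧ Avoids132 π ∧
        fStat 2 π = s 0 ∧ fStat 3 π = s 1} : ℤ)) :
    p = ∑ π ∈ perms132 n, weight132 π := by
  classical
  ext s
  have h (π : Fin n → ℤ) :
      coeff s (weight132 π) = if fStat 2 π = s 0 ∧ fStat 3 π = s 1 then 1 else 0 := by
    rw [weight132, X_pow_eq_monomial, X_pow_eq_monomial, monomial_mul, coeff_monomial, one_mul]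
    refine if_congr ?_ rfl rfl
    rw [Finsupp.ext_iff, Fin.forall_fin_two]
    simp
  rw [hp, coeff_sum]
  simp only [h]
  rw [← sum_filter, sum_const, nsmul_one, ← Nat.subtype_card]
  intro π
  rw [mem_filter, mem_perms132, and_assoc]

/-- The substitution `x ↦ x * y`, `y ↦ y`. -/
noncomputable def substXY : MvPolynomial (Fin 2) ℤ →ₐ[ℤ] MvPolynomial (Fin 2) ℤ :=
  bind₁ fun i => if i = 0 then X 0 * X 1 else X 1

lemma substXY_weight132 {m : ℕ} (w : Fin m → ℤ) :
    substXY (weight132 w) = (X 0 * X 1) ^ fStat 2 w * X 1 ^ fStat 3 w := by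
  simp [substXY, weight132]

lemma weight132_glue132 {a b : ℕ} {L : Fin a → ℤ} {R : Fin b → ℤ} (hL : L ∈ perms132 a)
    (hR : R ∈ perms132 b) :
    weight132 (glue132 L R) =
      (if b = 0 then 1 else X 0) * (substXY (weight132 L) * weight132 R) := by
  rw [substXY_weight132, weight132, weight132, fStat_two_glue132 hL hR, fStat_three_glue132 hL hR]
  split_ifs <;> ring

lemma sum_weight132_max_eq {n b : ℕ} (hb : b ≤ n) :
    ∑ π ∈ perms132 (n + 1) with
        π ⟨n - b, by omega⟩ = ((n + 1 : ℕ) : ℤ), weight132 π =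
      (if b = 0 then 1 else X 0) *
        (substXY (∑ L ∈ perms132 (n - b), weight132 L) * ∑ R ∈ perms132 b, weight132 R) := by
  obtain ⟨a, rfl⟩ := Nat.exists_eq_add_of_le' hb
  have hj : (⟨a + b - b, by omega⟩ : Fin (a + b + 1)) = Fin.natAdd a (0 : Fin (b + 1)) := by
    simp [Fin.ext_iff]
  simp only [hj]
  rw [sum_perms132_max_eq, Nat.add_sub_cancel, map_sum, sum_mul_sum, mul_sum]
  refine sum_congr rfl fun L hL => ?_
  rw [mul_sum]
  exact sum_congr rfl fun R hR => weight132_glue132 hL hR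

lemma sum_weight132_zero : ∑ π ∈ perms132 0, weight132 π = 1 := by
  have h : perms132 0 = {Fin.elim0} := by
    ext π
    simp [mem_perms132, IsPermSeq, Avoids132, Function.Injective, Subsingleton.elim π Fin.elim0]
  simp [h, weight132, fStat_two_eq_sum, fStat_three_eq_sum]

end Weight

/-- The bivariate polynomials
`T_n(x,y) = Σ_{π ∈ S_n(1-3-2)} x^{f_2(π)} y^{f_3(π)}` (with `x = X 0`,
`y = X 1`) satisfy `T_{n+1}(x,y) = T_n(xy,y) + x · Σ_{a+b=n, b≥1} T_a(xy,y)·T_b(x,y)`. -/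
theorem f2_f3_polynomial_recurrence (T : ℕ → MvPolynomial (Fin 2) ℤ)
    (hT : ∀ n, ∀ s : Fin 2 →₀ ℕ, MvPolynomial.coeff s (T n) =
      (Nat.card {π : Fin n → ℤ // IsPermSeq n π ∧ Avoids132 π ∧
        fStat 2 π = s 0 ∧ fStat 3 π = s 1} : ℤ)) :
    ∀ n, T (n + 1) =
      (MvPolynomial.bind₁ (fun i : Fin 2 =>
          if i = 0 then MvPolynomial.X 0 * MvPolynomial.X 1
          else MvPolynomial.X 1) (T n)) + MvPolynomial.X 0 *
        ∑ b ∈ Finset.Icc 1 n,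
          (MvPolynomial.bind₁ (fun i : Fin 2 =>
              if i = 0 then MvPolynomial.X 0 * MvPolynomial.X 1
              else MvPolynomial.X 1) (T (n - b))) * T b := by
  intro n
  have hsum (m : ℕ) := eq_sum_weight132 (hT m)
  have hrange : range (n + 1) = insert 0 (Icc 1 n) := by
    ext
    simp
    omega
  have hkey : T (n + 1) = ∑ b ∈ range (n + 1), (if b = 0 then 1 else MvPolynomial.X 0) *
      (MvPolynomial.bind₁ (fun i : Fin 2 =>
        if i = 0 then MvPolynomial.X 0 * MvPolynomial.X 1
        else MvPolynomial.X 1) (T (n - b)) * T b) := by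
    rw [hsum (n + 1), sum_perms132_succ, ← Equiv.sum_comp Fin.revPerm, Finset.sum_range]
    refine sum_congr rfl fun b _ => ?_
    have hb : (b : ℕ) ≤ n := by omega
    change _ = _ * (substXY _ * _)
    rw [hsum (n - b), hsum b, ← sum_weight132_max_eq hb]
    have hrev : Fin.revPerm b = ⟨n - b, by omega⟩ := by
      simp [Fin.ext_iff]
    rw [hrev]
  have hzero : T 0 = 1 := by
    rw [hsum 0, sum_weight132_zero]
  rw [hkey, hrange, sum_insert (by simp), mul_sum]
  congr 1
  · simp [hzero]
  · refine sum_congr rfl fun b hb => ?_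
    rw [if_neg (by have := (mem_Icc.1 hb).1; omega)]
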